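/- arXiv:1011.1352 — 2 statements merged into one kernel-verified Lean document; each statement's English description precedes it below -/
import Mathlib

section
/- Let γ_i and γ_j be independent exponentially distributed random variables with means λ̄_i > 0 and λ̄_j > 0, and set Z = γ_i γ_j / (γ_i + 2 γ_j). Then for every z > 0, P(Z ≤ z) = 1 − α z e^{−β z} K_1(α z), where α = 2 √(2/(λ̄_i λ̄_j)) and β = 1/λ̄_j + 2/λ̄_i. -/
open MeasureTheory ProbabilityTheory

/-- The modified Bessel function of the second kind,
`K ν x = ∫_0^∞ exp (-x cosh t) cosh (ν t) dt`. -/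
noncomputable def besselK (ν x : ℝ) : ℝ :=
  ∫ t in Set.Ioi (0 : ℝ), Real.exp (-x * Real.cosh t) * Real.cosh (ν * t)

/-- The law of an exponentially distributed random variable with mean `lam > 0`:
the measure with density `x ↦ (1/lam) exp (-x/lam)` on `(0, ∞)` w.r.t. Lebesgue measure. -/
noncomputable def expLaw (lam : ℝ) : Measure ℝ :=
  MeasureTheory.volume.withDensity
    (Set.indicator (Set.Ioi (0 : ℝ))
      (fun x => ENNReal.ofReal ((1 / lam) * Real.exp (-x / lam))))

lemma measurable_expLaw_density (lam : ℝ) :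
    Measurable (Set.indicator (Set.Ioi (0 : ℝ))
      (fun x => ENNReal.ofReal ((1 / lam) * Real.exp (-x / lam)))) := by
  refine Measurable.indicator ?_ measurableSet_Ioi
  fun_prop

lemma lintegral_expLaw (lam : ℝ) {f : ℝ → ENNReal} (hf : Measurable f) :
    ∫⁻ x, f x ∂expLaw lam =
      ∫⁻ x in Set.Ioi (0 : ℝ), ENNReal.ofReal ((1 / lam) * Real.exp (-x / lam)) * f x := by
  rw [expLaw, lintegral_withDensity_eq_lintegral_mul _ (measurable_expLaw_density lam) hf,
    ← lintegral_indicator measurableSet_Ioi]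
  congr with x
  by_cases hx : x ∈ Set.Ioi (0 : ℝ) <;> simp [hx]

lemma expLaw_apply (lam : ℝ) {s : Set ℝ} (hs : MeasurableSet s) :
    expLaw lam s =
      ∫⁻ x in Set.Ioi (0 : ℝ) ∩ s, ENNReal.ofReal ((1 / lam) * Real.exp (-x / lam)) := by
  rw [expLaw, withDensity_apply _ hs, setLIntegral_indicator measurableSet_Ioi]

lemma setLIntegral_Ioi_exp_density {lam : ℝ} (hlam : 0 < lam) (c : ℝ) :
    ∫⁻ x in Set.Ioi c, ENNReal.ofReal ((1 / lam) * Real.exp (-x / lam)) =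
      ENNReal.ofReal (Real.exp (-c / lam)) := by
  have hneg : -(1 / lam) < 0 := by simpa using hlam
  have hfun : (fun x : ℝ => (1 / lam) * Real.exp (-x / lam)) =
      fun x => (1 / lam) * Real.exp (-(1 / lam) * x) := by
    ext x
    congr 2
    ring
  rw [← ofReal_integral_eq_lintegral_ofReal]
  · rw [hfun, integral_const_mul, integral_exp_mul_Ioi hneg]
    congr 1
    rw [show -(1 / lam) * c = -c / lam by ring]
    field_simp
  · rw [hfun]
    exact (integrableOn_exp_mul_Ioi hneg c).const_mul _
  · exact Filter.Eventually.of_forall fun x => by positivity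

lemma toReal_lintegral_exp_cosh (x : ℝ) :
    (∫⁻ t : ℝ, ENNReal.ofReal (Real.exp (-x * Real.cosh t) * Real.exp t)).toReal =
      2 * besselK 1 x := by
  have hneg : ∫⁻ t in (Set.Ioi (0 : ℝ))ᶜ,
        ENNReal.ofReal (Real.exp (-x * Real.cosh t) * Real.exp t) =
      ∫⁻ t in Set.Ioi (0 : ℝ), ENNReal.ofReal (Real.exp (-x * Real.cosh t) * Real.exp (-t)) := by
    have h := (Measure.measurePreserving_neg (volume : Measure ℝ)).setLIntegral_comp_preimage_emb
      (MeasurableEquiv.neg ℝ).measurableEmbedding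
      (fun t => ENNReal.ofReal (Real.exp (-x * Real.cosh t) * Real.exp t)) (Set.Iic 0)
    rw [Set.compl_Ioi, ← h]
    simp only [Real.cosh_neg]
    rw [show (Neg.neg ⁻¹' Set.Iic (0 : ℝ)) = Set.Ici 0 by ext; simp]
    exact setLIntegral_congr Ioi_ae_eq_Ici.symm
  have hsum : ∫⁻ t : ℝ, ENNReal.ofReal (Real.exp (-x * Real.cosh t) * Real.exp t) =
      2 * ∫⁻ t in Set.Ioi (0 : ℝ),
        ENNReal.ofReal (Real.exp (-x * Real.cosh t) * Real.cosh (1 * t)) := by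
    rw [← lintegral_add_compl _ (measurableSet_Ioi (a := (0 : ℝ))), hneg,
      ← lintegral_add_left (by fun_prop), ← lintegral_const_mul _ (by fun_prop)]
    congr with t
    rw [← ENNReal.ofReal_add (by positivity) (by positivity),
      show (2 : ENNReal) = ENNReal.ofReal 2 by simp, ← ENNReal.ofReal_mul (by norm_num),
      one_mul, Real.cosh_eq t]
    congr 1
    ring
  rw [hsum, ENNReal.toReal_mul, besselK, integral_eq_lintegral_of_nonneg_ae]
  · simp
  · exact Filter.Eventually.of_forall fun t => by positivity
  · exact Continuous.aestronglyMeasurable (by fun_prop)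

lemma lt_mul_div_add_iff {x y z : ℝ} (hx : 0 < x) (hy : 0 < y) (hz : 0 < z) :
    z < x * y / (x + 2 * y) ↔ z < y ∧ 2 * z * y / (y - z) < x := by
  rw [lt_div_iff₀ (by positivity)]
  constructor
  · intro h
    have hzy : z < y := by
      by_contra! hle
      nlinarith [mul_pos hz hy, mul_le_mul_of_nonneg_left hle hx.le]
    refine ⟨hzy, ?_⟩
    rw [div_lt_iff₀ (by linarith)]
    linarith
  · rintro ⟨hzy, h⟩
    rw [div_lt_iff₀ (by linarith)] at h
    linarith

lemma expLaw_harmonic_section {lam y z : ℝ} (hlam : 0 < lam) (hy : 0 < y) (hz : 0 < z) :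
    expLaw lam {x | z < x * y / (x + 2 * y)} =
      (Set.Ioi z).indicator
        (fun y => ENNReal.ofReal (Real.exp (-(2 * z * y / (y - z)) / lam))) y := by
  rw [expLaw_apply lam (measurableSet_lt (by fun_prop) (by fun_prop))]
  by_cases hzy : z < y
  · have hset : Set.Ioi (0 : ℝ) ∩ {x | z < x * y / (x + 2 * y)} =
        Set.Ioi (2 * z * y / (y - z)) := by
      have hpos : 0 < 2 * z * y / (y - z) := div_pos (by positivity) (by linarith)
      ext x
      constructor
      · rintro ⟨hx, h⟩
        exact ((lt_mul_div_add_iff hx hy hz).1 h).2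
      · intro h
        have hx : 0 < x := hpos.trans h
        exact ⟨hx, (lt_mul_div_add_iff hx hy hz).2 ⟨hzy, h⟩⟩
    rw [hset, setLIntegral_Ioi_exp_density hlam, Set.indicator_of_mem (Set.mem_Ioi.2 hzy)]
  · have hset : Set.Ioi (0 : ℝ) ∩ {x | z < x * y / (x + 2 * y)} = ∅ := by
      ext x
      simp only [Set.mem_inter_iff, Set.mem_Ioi, Set.mem_ofPred_eq, Set.mem_empty_iff_false,
        iff_false, not_and]
      exact fun hx h => hzy ((lt_mul_div_add_iff hx hy hz).1 h).1
    rw [hset, Set.indicator_of_notMem (by simpa using hzy)]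
    simp

lemma expLaw_prod_harmonic {lami lamj z : ℝ} [SFinite (expLaw lami)]
    (hlami : 0 < lami) (hz : 0 < z) :
    ((expLaw lamj).prod (expLaw lami)) {p | z < p.2 * p.1 / (p.2 + 2 * p.1)} =
      ∫⁻ y in Set.Ioi z, ENNReal.ofReal ((1 / lamj) * Real.exp (-y / lamj)) *
        ENNReal.ofReal (Real.exp (-(2 * z * y / (y - z)) / lami)) := by
  have hS : MeasurableSet {p : ℝ × ℝ | z < p.2 * p.1 / (p.2 + 2 * p.1)} :=
    measurableSet_lt (by fun_prop) (by fun_prop)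
  have hinter : Set.Ioi z ∩ Set.Ioi 0 = Set.Ioi z :=
    Set.inter_eq_left.2 (Set.Ioi_subset_Ioi hz.le)
  rw [Measure.prod_apply hS, lintegral_expLaw lamj (measurable_measure_prodMk_left hS), ← hinter,
    ← setLIntegral_indicator measurableSet_Ioi]
  refine setLIntegral_congr_fun measurableSet_Ioi fun y hy => ?_
  simp only [Set.preimage_ofPred_eq]
  rw [expLaw_harmonic_section hlami hy hz]
  by_cases hzy : y ∈ Set.Ioi z <;> simp [hzy]

lemma setLIntegral_Ioi_eq_lintegral_exp (f : ℝ → ENNReal) (z : ℝ) {c : ℝ} (hc : 0 < c) :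
    ∫⁻ y in Set.Ioi z, f y =
      ∫⁻ t : ℝ, ENNReal.ofReal (c * Real.exp t) * f (z + c * Real.exp t) := by
  have himage : (fun t : ℝ => z + c * Real.exp t) '' Set.univ = Set.Ioi z := by
    ext y
    simp only [Set.image_univ, Set.mem_range, Set.mem_Ioi]
    constructor
    · rintro ⟨t, rfl⟩
      have : 0 < c * Real.exp t := by positivity
      linarith
    · intro hy
      refine ⟨Real.log ((y - z) / c), ?_⟩
      rw [Real.exp_log (div_pos (by linarith) hc)]
      field_simp
      ring
  have hinj : Function.Injective (fun t : ℝ => z + c * Real.exp t) := fun s t h =>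
    Real.exp_injective (mul_left_cancel₀ hc.ne' (add_left_cancel h))
  rw [← himage, lintegral_image_eq_lintegral_abs_deriv_mul MeasurableSet.univ
    (fun t _ => (((Real.hasDerivAt_exp t).const_mul c).const_add z).hasDerivWithinAt)
    hinj.injOn, Measure.restrict_univ]
  congr with t
  rw [abs_of_pos (by positivity)]

theorem cdf_of_Z
    {Ω : Type*} [MeasurableSpace Ω] (μpr : Measure Ω) [IsProbabilityMeasure μpr]
    (γi γj : Ω → ℝ) (hγi : Measurable γi) (hγj : Measurable γj)
    (lami lamj : ℝ) (hlami : 0 < lami) (hlamj : 0 < lamj)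
    (hlawi : Measure.map γi μpr = expLaw lami)
    (hlawj : Measure.map γj μpr = expLaw lamj)
    (hindep : IndepFun γi γj μpr)
    (α β : ℝ)
    (hα : α = 2 * Real.sqrt (2 / (lami * lamj)))
    (hβ : β = 1 / lamj + 2 / lami)
    (z : ℝ) (hz : 0 < z) :
    μpr {ω | γi ω * γj ω / (γi ω + 2 * γj ω) ≤ z} =
      ENNReal.ofReal (1 - α * z * Real.exp (-β * z) * besselK 1 (α * z)) := by
  have hαpos : 0 < α := by rw [hα]; positivity
  have hαsq : α ^ 2 * (lami * lamj) = 8 := by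
    rw [hα, mul_pow, Real.sq_sqrt (by positivity)]
    field_simp
    norm_num
  have : SFinite (expLaw lami) := hlawi ▸ inferInstance
  have hset : MeasurableSet {ω | γi ω * γj ω / (γi ω + 2 * γj ω) ≤ z} :=
    measurableSet_le (by fun_prop) (by fun_prop)
  have hjoint : μpr.map (fun ω => (γj ω, γi ω)) = (expLaw lamj).prod (expLaw lami) := by
    rw [← hlawi, ← hlawj]
    exact (indepFun_iff_map_prod_eq_prod_map_map hγj.aemeasurable hγi.aemeasurable).1 hindep.symm
  have htail : μpr {ω | γi ω * γj ω / (γi ω + 2 * γj ω) ≤ z}ᶜ =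
      ENNReal.ofReal (α * z / 2 * Real.exp (-β * z)) *
        ∫⁻ t : ℝ, ENNReal.ofReal (Real.exp (-(α * z) * Real.cosh t) * Real.exp t) := by
    have hpre : {ω | γi ω * γj ω / (γi ω + 2 * γj ω) ≤ z}ᶜ =
        (fun ω => (γj ω, γi ω)) ⁻¹' {p | z < p.2 * p.1 / (p.2 + 2 * p.1)} := by
      ext ω
      simp
    have hc : 0 < α * z * lamj / 2 := by positivity
    rw [hpre, ← Measure.map_apply (by fun_prop) (measurableSet_lt (by fun_prop) (by fun_prop)),
      hjoint, expLaw_prod_harmonic hlami hz, setLIntegral_Ioi_eq_lintegral_exp _ z hc,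
      ← lintegral_const_mul _ (by fun_prop)]
    congr with t
    rw [← ENNReal.ofReal_mul (by positivity), ← ENNReal.ofReal_mul (by positivity),
      ← ENNReal.ofReal_mul (by positivity)]
    congr 1
    have hexponent : -(z + α * z * lamj / 2 * Real.exp t) / lamj +
        -(2 * z * (z + α * z * lamj / 2 * Real.exp t) /
          (z + α * z * lamj / 2 * Real.exp t - z)) / lami =
        -β * z + -(α * z) * Real.cosh t := by
      rw [hβ, Real.cosh_eq, Real.exp_neg, add_sub_cancel_left]
      have he := Real.exp_pos t
      field_simp
      linear_combination hαsq
    calc _ = α * z / 2 * Real.exp t * (Real.exp (-(z + α * z * lamj / 2 * Real.exp t) / lamj) *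
          Real.exp (-(2 * z * (z + α * z * lamj / 2 * Real.exp t) /
            (z + α * z * lamj / 2 * Real.exp t - z)) / lami)) := by
          field_simp
      _ = _ := by
          rw [← Real.exp_add, hexponent, Real.exp_add]
          ring
  rw [← ofReal_measureReal, ← compl_compl {ω | γi ω * γj ω / (γi ω + 2 * γj ω) ≤ z},
    probReal_compl_eq_one_sub hset.compl, measureReal_def, htail, ENNReal.toReal_mul,
    toReal_lintegral_exp_cosh, ENNReal.toReal_ofReal (by positivity)]
  congr 1
  ring
end

section
/- Let γ_1 and γ_2 be independent exponentially distributed random variables with means λ̄_1 > 0 and λ̄_2 > 0, and set W = γ_1 γ_2 / (γ_1 + γ_2). Then the law of W has density on (0,∞) given by f_W(w) = α w e^{−β w} [ α K_0(α w) + β K_1(α w) ], where α = 2/√(λ̄_1 λ̄_2) and β = 1/λ̄_1 + 1/λ̄_2; equivalently f_W(w) = (2w/√(λ̄_1 λ̄_2)) e^{−(1/λ̄_1 + 1/λ̄_2) w} [ (2/√(λ̄_1 λ̄_2)) K_0(2w/√(λ̄_1 λ̄_2)) + ((λ̄_1 + λ̄_2)/(λ̄_1 λ̄_2)) K_1(2w/√(λ̄_1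 λ̄_2)) ]. -/
open MeasureTheory ProbabilityTheory

open Set Filter Topology

lemma integrableOn_exp_neg_mul_cosh_mul_cosh {ν x : ℝ} (hν : |ν| ≤ 1) (hx : 0 < x) :
    IntegrableOn (fun t => Real.exp (-x * Real.cosh t) * Real.cosh (ν * t)) (Ioi 0) := by
  have hsinh : Tendsto Real.sinh atTop atTop :=
    tendsto_atTop_mono' atTop
      ((eventually_ge_atTop 0).mono fun t ht => Real.self_le_sinh_iff.2 ht) tendsto_id
  have hdom : IntegrableOn
      (fun t => Real.exp (-x * Real.sinh t) * (-x * Real.cosh t)) (Ioi 0) := by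
    refine integrableOn_Ioi_deriv_of_nonpos' (g := fun t => Real.exp (-x * Real.sinh t)) (l := 0)
      (fun t _ => ((Real.hasDerivAt_sinh t).const_mul (-x)).exp) (fun t _ => ?_) ?_
    · have := mul_pos (Real.exp_pos (-x * Real.sinh t)) (mul_pos hx (Real.cosh_pos t))
      linarith
    · exact Real.tendsto_exp_atBot.comp (hsinh.const_mul_atTop_of_neg (neg_lt_zero.2 hx))
  refine (hdom.const_mul (-x⁻¹)).mono' (by fun_prop) (ae_of_all _ fun t => ?_)
  rw [Real.norm_of_nonneg (by positivity)]
  have hcosh : Real.cosh (ν * t) ≤ Real.cosh t := by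
    rw [Real.cosh_le_cosh, abs_mul]
    exact mul_le_of_le_one_left (abs_nonneg t) hν
  have hexp : Real.exp (-x * Real.cosh t) ≤ Real.exp (-x * Real.sinh t) :=
    Real.exp_le_exp.2 (mul_le_mul_of_nonpos_left (Real.sinh_lt_cosh t).le (by linarith))
  calc Real.exp (-x * Real.cosh t) * Real.cosh (ν * t)
      ≤ Real.exp (-x * Real.sinh t) * Real.cosh t := by gcongr
    _ = -x⁻¹ * (Real.exp (-x * Real.sinh t) * (-x * Real.cosh t)) := by field_simp

lemma lintegral_eq_lintegral_Ioi_add_comp_neg {f : ℝ → ENNReal} (hf : Measurable f) :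
    ∫⁻ t, f t = ∫⁻ t in Ioi 0, (f t + f (-t)) := by
  have hneg : ∫⁻ t in Ioi (0 : ℝ), f (-t) = ∫⁻ t in Iio 0, f t := by
    have := (Measure.measurePreserving_neg (volume : Measure ℝ)).setLIntegral_comp_preimage
      (measurableSet_Iio (a := (0 : ℝ))) hf
    simpa using this
  rw [lintegral_add_left hf, hneg, ← lintegral_add_compl f measurableSet_Ioi, compl_Ioi,
    setLIntegral_congr Iio_ae_eq_Iic]

lemma lintegral_exp_neg_mul_cosh_mul {a b x d : ℝ} (ha : 0 ≤ a) (hb : 0 < b) (hx : 0 < x)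
    (hd : 0 ≤ d) :
    ∫⁻ s, ENNReal.ofReal
        (d * (Real.exp (-x * Real.cosh s) * (a + b * Real.exp s + b⁻¹ * Real.exp (-s)))) =
      ENNReal.ofReal (d * (2 * a * besselK 0 x + 2 * (b + b⁻¹) * besselK 1 x)) := by
  have h0 := integrableOn_exp_neg_mul_cosh_mul_cosh (ν := 0) (by simp) hx
  have h1 := integrableOn_exp_neg_mul_cosh_mul_cosh (ν := 1) (by simp) hx
  have hint : IntegrableOn (fun s =>
      d * (2 * a * (Real.exp (-x * Real.cosh s) * Real.cosh (0 * s)) +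
        2 * (b + b⁻¹) * (Real.exp (-x * Real.cosh s) * Real.cosh (1 * s)))) (Ioi 0) :=
    ((h0.const_mul _).add (h1.const_mul _)).const_mul _
  rw [lintegral_eq_lintegral_Ioi_add_comp_neg (by fun_prop), besselK, besselK,
    ← integral_const_mul, ← integral_const_mul,
    ← integral_add (h0.const_mul _) (h1.const_mul _), ← integral_const_mul,
    ofReal_integral_eq_lintegral_ofReal hint
      (ae_of_all _ fun s => by
        have := Real.cosh_pos (0 * s)
        have := Real.cosh_pos (1 * s)
        simp only [Pi.zero_apply]
        positivity)]
  refine lintegral_congr fun s => ?_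
  rw [← ENNReal.ofReal_add (by positivity) (by positivity)]
  simp only [Real.cosh_neg, neg_neg, zero_mul, one_mul, Real.cosh_zero]
  congr 1
  have := Real.cosh_eq s
  generalize Real.exp (-x * Real.cosh s) = E
  rw [this]
  ring

/-- Parametrization of the open quadrant by `(w, s)`, where `w = x y / (x + y)` and
`c * exp s = x / y`. -/
noncomputable def quadrantParam (c : ℝ) (p : ℝ × ℝ) : ℝ × ℝ :=
  (p.1 * (1 + c * Real.exp p.2), p.1 * (1 + c⁻¹ * Real.exp (-p.2)))

/-- The derivative of `quadrantParam`. -/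
noncomputable def fderivQuadrantParam (c : ℝ) (p : ℝ × ℝ) : ℝ × ℝ →L[ℝ] ℝ × ℝ :=
  (Matrix.toLin (.finTwoProd ℝ) (.finTwoProd ℝ)
    !![1 + c * Real.exp p.2, p.1 * (c * Real.exp p.2);
      1 + c⁻¹ * Real.exp (-p.2), -(p.1 * (c⁻¹ * Real.exp (-p.2)))]).toContinuousLinearMap

lemma hasFDerivAt_quadrantParam (c : ℝ) (p : ℝ × ℝ) :
    HasFDerivAt (quadrantParam c) (fderivQuadrantParam c p) p := by
  have hx : HasDerivAt (fun s => 1 + c * Real.exp s) (c * Real.exp p.2) p.2 :=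
    ((Real.hasDerivAt_exp p.2).const_mul c).const_add 1
  have hy : HasDerivAt (fun s => 1 + c⁻¹ * Real.exp (-s)) (-(c⁻¹ * Real.exp (-p.2))) p.2 := by
    simpa using (((hasDerivAt_neg p.2).exp).const_mul c⁻¹).const_add 1
  unfold fderivQuadrantParam
  rw [Matrix.toLin_finTwoProd_toContinuousLinearMap]
  convert! HasFDerivAt.prodMk (𝕜 := ℝ)
    (hasFDerivAt_fst.mul (hx.comp_hasFDerivAt p hasFDerivAt_snd))
    (hasFDerivAt_fst.mul (hy.comp_hasFDerivAt p hasFDerivAt_snd)) using 2 <;>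
  simp [smul_smul, add_comm, neg_smul _ (ContinuousLinearMap.snd ℝ ℝ ℝ)]

lemma det_fderivQuadrantParam {c : ℝ} (hc : c ≠ 0) (p : ℝ × ℝ) :
    (fderivQuadrantParam c p).det =
      -(p.1 * (2 + c * Real.exp p.2 + c⁻¹ * Real.exp (-p.2))) := by
  unfold fderivQuadrantParam
  simp only [LinearMap.det_toContinuousLinearMap, LinearMap.det_toLin, Matrix.det_fin_two_of,
    Real.exp_neg]
  field_simp
  ring

lemma quadrantParam_mul_div_add {c : ℝ} (hc : 0 < c) {p : ℝ × ℝ} (hp : 0 < p.1) :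
    (quadrantParam c p).1 * (quadrantParam c p).2 /
      ((quadrantParam c p).1 + (quadrantParam c p).2) = p.1 := by
  simp only [quadrantParam, Real.exp_neg]
  have := Real.exp_pos p.2
  field_simp
  ring

lemma injOn_quadrantParam {c : ℝ} (hc : 0 < c) :
    InjOn (quadrantParam c) (Ioi 0 ×ˢ univ) := by
  intro p hp q hq h
  have h1 : p.1 = q.1 := by
    rw [← quadrantParam_mul_div_add hc hp.1, ← quadrantParam_mul_div_add hc hq.1, h]
  have hp1 : p.1 ≠ 0 := ne_of_gt hp.1
  have h2 : p.1 * (1 + c * Real.exp p.2) = q.1 * (1 + c * Real.exp q.2) := congrArg Prod.fst h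
  rw [← h1] at h2
  refine Prod.ext h1 (Real.exp_injective ?_)
  exact mul_left_cancel₀ hc.ne' (add_left_cancel (mul_left_cancel₀ hp1 h2))

lemma image_quadrantParam {c : ℝ} (hc : 0 < c) :
    quadrantParam c '' (Ioi 0 ×ˢ univ) = Ioi 0 ×ˢ Ioi 0 := by
  ext ⟨x, y⟩
  constructor
  · rintro ⟨p, ⟨hp, -⟩, h⟩
    have hp : 0 < p.1 := hp
    rw [← h]
    exact ⟨show 0 < p.1 * _ by positivity, show 0 < p.1 * _ by positivity⟩
  · rintro ⟨hx, hy⟩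
    have hx : 0 < x := hx
    have hy : 0 < y := hy
    refine ⟨(x * y / (x + y), Real.log (x / (c * y))), ⟨show 0 < x * y / (x + y) by positivity, trivial⟩, ?_⟩
    have hlog : Real.exp (Real.log (x / (c * y))) = x / (c * y) := Real.exp_log (by positivity)
    simp only [quadrantParam, Real.exp_neg, hlog, Prod.mk.injEq]
    constructor <;> field_simp
    ring

lemma lintegral_quadrant_eq {c : ℝ} (hc : 0 < c) (g : ℝ × ℝ → ENNReal) (hg : Measurable g) :
    ∫⁻ z in Ioi 0 ×ˢ Ioi 0, g z =
      ∫⁻ w in Ioi 0, ∫⁻ s,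
        ENNReal.ofReal (w * (2 + c * Real.exp s + c⁻¹ * Real.exp (-s))) *
          g (quadrantParam c (w, s)) := by
  have hmeas : Measurable (quadrantParam c) := by unfold quadrantParam; fun_prop
  have hS : MeasurableSet (Ioi (0 : ℝ) ×ˢ (univ : Set ℝ)) := measurableSet_Ioi.prod .univ
  rw [← image_quadrantParam hc, lintegral_image_eq_lintegral_abs_det_fderiv_mul volume
    hS (fun p _ => (hasFDerivAt_quadrantParam c p).hasFDerivWithinAt) (injOn_quadrantParam hc)]
  have hdet : ∀ p ∈ Ioi (0 : ℝ) ×ˢ (univ : Set ℝ),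
      ENNReal.ofReal |(fderivQuadrantParam c p).det| * g (quadrantParam c p) =
        ENNReal.ofReal (p.1 * (2 + c * Real.exp p.2 + c⁻¹ * Real.exp (-p.2))) *
          g (quadrantParam c p) := by
    rintro p ⟨hp, -⟩
    have hp : 0 < p.1 := hp
    rw [det_fderivQuadrantParam hc.ne', abs_neg, abs_of_nonneg (by positivity)]
  rw [setLIntegral_congr_fun hS hdet, Measure.volume_eq_prod, setLIntegral_prod _ (by fun_prop)]
  simp only [Measure.restrict_univ]

lemma expLaw_eq_withDensity_restrict (lam : ℝ) :
    expLaw lam = (volume.restrict (Ioi 0)).withDensity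
      (fun x => ENNReal.ofReal ((1 / lam) * Real.exp (-x / lam))) :=
  withDensity_indicator measurableSet_Ioi _

lemma expLaw_prod_expLaw (lam1 lam2 : ℝ) :
    (expLaw lam1).prod (expLaw lam2) =
      (volume.restrict (Ioi 0 ×ˢ Ioi 0)).withDensity (fun z : ℝ × ℝ =>
        ENNReal.ofReal ((1 / lam1) * Real.exp (-z.1 / lam1)) *
          ENNReal.ofReal ((1 / lam2) * Real.exp (-z.2 / lam2))) := by
  rw [expLaw_eq_withDensity_restrict, expLaw_eq_withDensity_restrict,
    prod_withDensity (by fun_prop) (by fun_prop), Measure.prod_restrict, Measure.volume_eq_prod]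

lemma exp_density_quadrantParam {lam1 lam2 w : ℝ} (hlam1 : 0 < lam1) (hlam2 : 0 < lam2) (s : ℝ) :
    Real.exp (-(quadrantParam √(lam1 / lam2) (w, s)).1 / lam1) *
        Real.exp (-(quadrantParam √(lam1 / lam2) (w, s)).2 / lam2) =
      Real.exp (-(1 / lam1 + 1 / lam2) * w) *
        Real.exp (-(2 / √(lam1 * lam2) * w) * Real.cosh s) := by
  rw [← Real.exp_add, ← Real.exp_add, Real.cosh_eq, Real.sqrt_div hlam1.le,
    Real.sqrt_mul hlam1.le]
  congr 1
  simp only [quadrantParam]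
  have h1 := Real.sq_sqrt hlam1.le
  have h2 := Real.sq_sqrt hlam2.le
  have p1 := Real.sqrt_pos.2 hlam1
  have p2 := Real.sqrt_pos.2 hlam2
  generalize √lam1 = a at *
  generalize √lam2 = b at *
  subst h1 h2
  field_simp
  ring

lemma lintegral_expLaw_prod_fiber {lam1 lam2 w : ℝ} (hlam1 : 0 < lam1) (hlam2 : 0 < lam2)
    (hw : 0 < w) :
    ∫⁻ s, ENNReal.ofReal
        (w * (2 + √(lam1 / lam2) * Real.exp s + (√(lam1 / lam2))⁻¹ * Real.exp (-s))) *
        (ENNReal.ofReal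
            ((1 / lam1) * Real.exp (-(quadrantParam √(lam1 / lam2) (w, s)).1 / lam1)) *
          ENNReal.ofReal
            ((1 / lam2) * Real.exp (-(quadrantParam √(lam1 / lam2) (w, s)).2 / lam2))) =
      ENNReal.ofReal (2 / √(lam1 * lam2) * w * Real.exp (-(1 / lam1 + 1 / lam2) * w) *
        (2 / √(lam1 * lam2) * besselK 0 (2 / √(lam1 * lam2) * w) +
          (1 / lam1 + 1 / lam2) * besselK 1 (2 / √(lam1 * lam2) * w))) := by
  have hc : 0 < √(lam1 / lam2) := Real.sqrt_pos.2 (by positivity)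
  have hcalc := lintegral_exp_neg_mul_cosh_mul (a := 2) (x := 2 / √(lam1 * lam2) * w)
    (d := 1 / lam1 * (1 / lam2) * w * Real.exp (-(1 / lam1 + 1 / lam2) * w))
    zero_le_two hc (by positivity) (by positivity)
  convert hcalc using 1
  · refine lintegral_congr fun s => ?_
    rw [← ENNReal.ofReal_mul (by positivity), ← ENNReal.ofReal_mul (by positivity)]
    congr 1
    linear_combination (w * (2 + √(lam1 / lam2) * Real.exp s +
      (√(lam1 / lam2))⁻¹ * Real.exp (-s)) * (1 / lam1 * (1 / lam2))) *
        exp_density_quadrantParam (w := w) hlam1 hlam2 s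
  · congr 1
    generalize besselK 0 _ = K0
    generalize besselK 1 _ = K1
    generalize Real.exp _ = E
    rw [Real.sqrt_div hlam1.le, Real.sqrt_mul hlam1.le]
    have h1 := Real.sq_sqrt hlam1.le
    have h2 := Real.sq_sqrt hlam2.le
    have p1 := Real.sqrt_pos.2 hlam1
    have p2 := Real.sqrt_pos.2 hlam2
    generalize √lam1 = a at *
    generalize √lam2 = b at *
    subst h1 h2
    field_simp
    ring

theorem density_of_W
    {Ω : Type*} [MeasurableSpace Ω] (μpr : Measure Ω) [IsProbabilityMeasure μpr]
    (γ1 γ2 : Ω → ℝ) (hγ1 : Measurable γ1) (hγ2 : Measurable γ2)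
    (lam1 lam2 : ℝ) (hlam1 : 0 < lam1) (hlam2 : 0 < lam2)
    (hlaw1 : Measure.map γ1 μpr = expLaw lam1)
    (hlaw2 : Measure.map γ2 μpr = expLaw lam2)
    (hindep : IndepFun γ1 γ2 μpr)
    (α β : ℝ)
    (hα : α = 2 / Real.sqrt (lam1 * lam2))
    (hβ : β = 1 / lam1 + 1 / lam2) :
    Measure.map (fun ω => γ1 ω * γ2 ω / (γ1 ω + γ2 ω)) μpr =
      MeasureTheory.volume.withDensity
        (Set.indicator (Set.Ioi (0 : ℝ))
          (fun w => ENNReal.ofReal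
            (α * w * Real.exp (-β * w) *
              (α * besselK 0 (α * w) + β * besselK 1 (α * w))))) := by
  subst hα hβ
  have hc : 0 < √(lam1 / lam2) := Real.sqrt_pos.2 (by positivity)
  have hF : Measurable (fun z : ℝ × ℝ => z.1 * z.2 / (z.1 + z.2)) := by fun_prop
  have hjoint : Measure.map (fun ω => (γ1 ω, γ2 ω)) μpr = (expLaw lam1).prod (expLaw lam2) := by
    rw [hindep.map_prod_eq_prod_map_map hγ1.aemeasurable hγ2.aemeasurable, hlaw1, hlaw2]
  have hmap : Measure.map (fun ω => γ1 ω * γ2 ω / (γ1 ω + γ2 ω)) μpr =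
      Measure.map (fun z : ℝ × ℝ => z.1 * z.2 / (z.1 + z.2))
        ((expLaw lam1).prod (expLaw lam2)) := by
    rw [← hjoint, Measure.map_map hF (by fun_prop)]
    rfl
  rw [hmap, expLaw_prod_expLaw lam1 lam2, withDensity_indicator measurableSet_Ioi]
  ext A hA
  rw [Measure.map_apply hF hA, withDensity_apply _ (hF hA), withDensity_apply _ hA,
    ← lintegral_indicator (hF hA), lintegral_quadrant_eq hc _
      (Measurable.indicator (by fun_prop) (hF hA)), ← lintegral_indicator hA]
  refine setLIntegral_congr_fun measurableSet_Ioi fun w hw => ?_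
  by_cases hwA : w ∈ A
  · rw [indicator_of_mem hwA, ← lintegral_expLaw_prod_fiber hlam1 hlam2 hw]
    refine lintegral_congr fun s => ?_
    rw [indicator_of_mem]
    simpa only [mem_preimage, quadrantParam_mul_div_add (p := (w, s)) hc hw] using hwA
  · rw [indicator_of_notMem hwA]
    refine (lintegral_congr fun s => ?_).trans lintegral_zero
    rw [indicator_of_notMem, mul_zero]
    simpa only [mem_preimage, quadrantParam_mul_div_add (p := (w, s)) hc hw] using hwA
end
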